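/- Let n be a positive integer, G a finite group, and φ : Γ¹(n) → G a group homomorphism such that φ(γ) = 1 for every parabolic element γ of Γ¹(n), and such that φ(−I) = 1 whenever −I ∈ Γ¹(n). If ker φ ≠ Γ¹(n), then ker φ, viewed as a subgroup of SL₂(ℤ), is not a congruence subgroup; i.e., ker φ contains no principal congruence subgroup Γ(m). -/

import Mathlib

open Matrix Matrix.SpecialLinearGroup CongruenceSubgroup

open scoped MatrixGroups

/-- `Γ¹(N)`: the congruence subgroup of `SL(2, ℤ)` of matrices whose upper
right-hand entry reduces to zero and whose diagonal entries reduce to one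
modulo `N`. -/
def GammaUpper1 (N : ℕ) : Subgroup SL(2, ℤ) where
  carrier := { g | (g 0 1 : ZMod N) = 0 ∧ (g 0 0 : ZMod N) = 1 ∧ (g 1 1 : ZMod N) = 1 }
  one_mem' := by simp
  mul_mem' := by
    intro a b ha hb
    have h00 := (Matrix.two_mul_expl a.1 b.1).1
    have h01 := (Matrix.two_mul_expl a.1 b.1).2.1
    have h11 := (Matrix.two_mul_expl a.1 b.1).2.2.2
    simp only [Set.mem_setOf_eq, coe_matrix_coe, coe_mul, Int.coe_castRingHom, map_apply] at *
    rw [h00, h01, h11]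
    push_cast
    rw [ha.1, ha.2.1, ha.2.2, hb.1, hb.2.1, hb.2.2]
    simp
  inv_mem' := by
    intro a ha
    simp only [Set.mem_setOf_eq] at *
    rw [SL2_inv_expl a]
    simp only [cons_val_zero, cons_val_one, head_cons, coe_matrix_coe,
      coe_mk, Int.coe_castRingHom, map_apply, Int.cast_neg, neg_eq_zero] at *
    exact ⟨ha.1, ha.2.2, ha.2.1⟩

/-- An element of `SL(2, ℤ)` is parabolic if it is not `±I` and its trace is `±2`. -/
def IsParabolic (γ : SL(2, ℤ)) : Prop :=
  γ ≠ 1 ∧ γ ≠ -1 ∧ ((γ 0 0 : ℤ) + γ 1 1 = 2 ∨ (γ 0 0 : ℤ) + γ 1 1 = -2)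

/-- If `a` and `b` are coprime then some `a + k * b` is coprime to any given nonzero `m`. -/
theorem Int.exists_isCoprime_add_mul {a b : ℤ} (h : IsCoprime a b) {m : ℕ} (hm : m ≠ 0) :
    ∃ k : ℤ, IsCoprime (a + k * b) m := by
  classical
  let ps : Finset ℕ := {p ∈ m.primeFactors | ¬ (p : ℤ) ∣ a}
  refine ⟨∏ p ∈ ps, (p : ℤ), ?_⟩
  rw [Int.isCoprime_iff_nat_coprime, Int.natAbs_natCast]
  refine Nat.coprime_of_dvd fun p pp hp hpm ↦ ?_
  rw [← Int.natCast_dvd] at hp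
  have hpZ : Prime (p : ℤ) := Nat.prime_iff_prime_int.mp pp
  by_cases hpa : (p : ℤ) ∣ a
  · rcases hpZ.dvd_mul.mp ((dvd_add_right hpa).mp hp) with hdvd | hdvd
    · obtain ⟨q, hq, hpq⟩ := (hpZ.dvd_finsetProd_iff _).mp hdvd
      rw [Finset.mem_filter, Nat.mem_primeFactors] at hq
      rw [Int.natCast_dvd_natCast, Nat.prime_dvd_prime_iff_eq pp hq.1.1] at hpq
      exact hq.2 (hpq ▸ hpa)
    · exact hpZ.not_isUnit (h.isUnit_of_dvd' hpa hdvd)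
  · have hps : p ∈ ps := Finset.mem_filter.mpr ⟨Nat.mem_primeFactors.mpr ⟨pp, hpm, hm⟩, hpa⟩
    exact hpa ((dvd_add_left ((Finset.dvd_prod_of_mem _ hps).mul_right b)).mp hp)

namespace Matrix.SpecialLinearGroup

/-- The lower unipotent matrix with lower-left entry `x`. -/
def lowerUnipotent {R : Type*} [CommRing R] (x : R) : SL(2, R) := ⟨!![1, 0; x, 1], by simp⟩

/-- The upper unipotent matrix with upper-right entry `x`. -/
def upperUnipotent {R : Type*} [CommRing R] (x : R) : SL(2, R) := ⟨!![1, x; 0, 1], by simp⟩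

@[simp]
theorem coe_lowerUnipotent {R : Type*} [CommRing R] (x : R) :
    (lowerUnipotent x : Matrix (Fin 2) (Fin 2) R) = !![1, 0; x, 1] := rfl

@[simp]
theorem coe_upperUnipotent {R : Type*} [CommRing R] (x : R) :
    (upperUnipotent x : Matrix (Fin 2) (Fin 2) R) = !![1, x; 0, 1] := rfl

end Matrix.SpecialLinearGroup

theorem mem_GammaUpper1 {N : ℕ} {g : SL(2, ℤ)} :
    g ∈ GammaUpper1 N ↔ (g 0 1 : ZMod N) = 0 ∧ (g 0 0 : ZMod N) = 1 ∧ (g 1 1 : ZMod N) = 1 :=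
  Iff.rfl

theorem lowerUnipotent_mem_GammaUpper1 (n : ℕ) (x : ℤ) : lowerUnipotent x ∈ GammaUpper1 n := by
  simp [mem_GammaUpper1]

theorem upperUnipotent_mem_GammaUpper1 (n : ℕ) (x : ℤ) :
    upperUnipotent (n * x) ∈ GammaUpper1 n := by
  simp [mem_GammaUpper1]

theorem lowerUnipotent_eq_one_or_isParabolic (x : ℤ) :
    lowerUnipotent x = 1 ∨ IsParabolic (lowerUnipotent x) := by
  refine or_iff_not_imp_left.mpr fun h ↦ ⟨h, fun h' ↦ ?_, Or.inl ?_⟩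
  · simpa using congrArg (fun g : SL(2, ℤ) ↦ g 0 0) h'
  · simp

theorem upperUnipotent_eq_one_or_isParabolic (x : ℤ) :
    upperUnipotent x = 1 ∨ IsParabolic (upperUnipotent x) := by
  refine or_iff_not_imp_left.mpr fun h ↦ ⟨h, fun h' ↦ ?_, Or.inl ?_⟩
  · simpa using congrArg (fun g : SL(2, ℤ) ↦ g 0 0) h'
  · simp

/-- Matrices in `SL(2, ℤ)` which agree modulo `m` lie in the same right coset of `Γ(m)`. -/
theorem mul_inv_mem_Gamma {m : ℕ} {g h : SL(2, ℤ)}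
    (H : ∀ i j, (g i j : ZMod m) = (h i j : ZMod m)) : g * h⁻¹ ∈ Gamma m := by
  rw [Gamma_mem', map_mul, map_inv, mul_inv_eq_one]
  ext i j
  simpa using H i j

/-- A subgroup containing `Γ(m)` and the elementary unipotents of `Γ¹(n)` contains every matrix
of `Γ¹(n)` whose upper-left entry is prime to `m`. -/
theorem mem_of_isCoprime_of_unipotent_mem {n m : ℕ} {K : Subgroup SL(2, ℤ)}
    (hL : ∀ x : ℤ, lowerUnipotent x ∈ K) (hU : ∀ x : ℤ, upperUnipotent (n * x) ∈ K)
    (hm : Gamma m ≤ K) {g : SL(2, ℤ)} (hg : g ∈ GammaUpper1 n) (hgm : IsCoprime (g 0 0) (m : ℤ)) :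
    g ∈ K := by
  obtain ⟨hb, ha, -⟩ := mem_GammaUpper1.mp hg
  obtain ⟨b, hb⟩ := (ZMod.intCast_zmod_eq_zero_iff_dvd _ _).mp hb
  obtain ⟨t, ht⟩ : (n : ℤ) ∣ g 0 0 - 1 := by
    rw [← ZMod.intCast_zmod_eq_zero_iff_dvd]
    simp [ha]
  have ha' : g 0 0 = 1 + n * t := by linarith
  obtain ⟨u, v, huv⟩ := hgm
  have hu : (u : ZMod m) * (1 + n * t) = 1 := by
    simpa [ha'] using congrArg (Int.cast : ℤ → ZMod m) huv
  set h : SL(2, ℤ) := lowerUnipotent (u * (g 1 0 - t)) * upperUnipotent ((n : ℤ) * 1) *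
    lowerUnipotent t * upperUnipotent (n * (u * (b - 1))) with h_def
  have hK : h ∈ K := mul_mem (mul_mem (mul_mem (hL _) (hU _)) (hL _)) (hU _)
  have h00 : (g 0 0 : ZMod m) = h 0 0 := by
    simp [h_def, ha', Matrix.mul_apply, Fin.sum_univ_two]
  have h01 : (g 0 1 : ZMod m) = h 0 1 := by
    simp [h_def, hb, Matrix.mul_apply, Fin.sum_univ_two]
    linear_combination (-(n : ZMod m) * (b - 1)) * hu
  have h10 : (g 1 0 : ZMod m) = h 1 0 := by
    simp [h_def, Matrix.mul_apply, Fin.sum_univ_two]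
    linear_combination (-((g 1 0 : ZMod m) - t)) * hu
  have h11 : (g 1 1 : ZMod m) = h 1 1 := by
    have hdet (k : SL(2, ℤ)) : (k 0 0 : ZMod m) * k 1 1 - k 0 1 * k 1 0 = 1 := by
      have := congrArg (Int.cast : ℤ → ZMod m) ((Matrix.det_fin_two k.1).symm.trans k.2)
      simpa using this
    have hg' := hdet g
    have hh' := hdet h
    rw [← h00, ← h01, ← h10] at hh'
    have ha'' : (g 0 0 : ZMod m) = 1 + n * t := by simp [ha']
    rw [ha''] at hg' hh'
    linear_combination u * hg' - u * hh' - ((g 1 1 : ZMod m) - h 1 1) * hu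
  have key : g * h⁻¹ ∈ K := hm <| mul_inv_mem_Gamma fun i j ↦ by
    fin_cases i <;> fin_cases j <;> assumption
  simpa using mul_mem key hK

/-- A subgroup containing `Γ(m)` and the elementary unipotents of `Γ¹(n)` contains `Γ¹(n)`. -/
theorem GammaUpper1_le_of_unipotent_mem {n m : ℕ} (hm0 : m ≠ 0) {K : Subgroup SL(2, ℤ)}
    (hL : ∀ x : ℤ, lowerUnipotent x ∈ K) (hU : ∀ x : ℤ, upperUnipotent (n * x) ∈ K)
    (hm : Gamma m ≤ K) : GammaUpper1 n ≤ K := by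
  intro g hg
  have hdet : g 0 0 * g 1 1 - g 0 1 * g 1 0 = 1 := (Matrix.det_fin_two g.1).symm.trans g.2
  have hab : IsCoprime (g 0 0) (g 0 1) := ⟨g 1 1, -g 1 0, by linear_combination hdet⟩
  obtain ⟨k, hk⟩ := Int.exists_isCoprime_add_mul hab hm0
  have key : g * lowerUnipotent k ∈ K := by
    refine mem_of_isCoprime_of_unipotent_mem hL hU hm
      (mul_mem hg (lowerUnipotent_mem_GammaUpper1 n k)) ?_
    simpa [Matrix.mul_apply, Fin.sum_univ_two, mul_comm] using hk
  exact (Subgroup.mul_mem_cancel_right K (hL k)).mp key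

/-- the `Γ¹(n)` case of Proposition 3.4 of the paper.
Let `n ≥ 1`, `G` a finite group, and `φ : Γ¹(n) → G` a homomorphism killing all
parabolic elements of `Γ¹(n)`, and killing `-I` whenever `-I ∈ Γ¹(n)`.  If
`ker φ ≠ Γ¹(n)`, then `ker φ` (viewed inside `SL(2, ℤ)`) is not a congruence
subgroup, i.e. it contains no principal congruence subgroup `Γ(m)`. -/
theorem kernel_of_typeII_hom_on_GammaUpper1_noncongruence
    (n : ℕ) (hn : 0 < n) {G : Type*} [Group G] [Finite G]
    (φ : GammaUpper1 n →* G)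
    (hI : ∀ γ : GammaUpper1 n, (γ : SL(2, ℤ)) = -1 → φ γ = 1)
    (hpar : ∀ γ : GammaUpper1 n, IsParabolic (γ : SL(2, ℤ)) → φ γ = 1)
    (hker : φ.ker ≠ ⊤) :
    ∀ m : ℕ, 1 ≤ m →
      ¬ CongruenceSubgroup.Gamma m ≤ Subgroup.map (GammaUpper1 n).subtype φ.ker := by
  intro m hm hle
  have hK {g : SL(2, ℤ)} (hg : g ∈ GammaUpper1 n) (h : g = 1 ∨ IsParabolic g) :
      g ∈ Subgroup.map (GammaUpper1 n).subtype φ.ker := by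
    rcases h with rfl | h
    · exact one_mem _
    · exact ⟨⟨g, hg⟩, hpar ⟨g, hg⟩ h, rfl⟩
  have key := GammaUpper1_le_of_unipotent_mem (by omega)
    (fun x ↦ hK (lowerUnipotent_mem_GammaUpper1 n x) (lowerUnipotent_eq_one_or_isParabolic x))
    (fun x ↦ hK (upperUnipotent_mem_GammaUpper1 n x) (upperUnipotent_eq_one_or_isParabolic _)) hle
  refine hker ((Subgroup.eq_top_iff' _).mpr fun g ↦ ?_)
  obtain ⟨g', hg', h⟩ := key g.2
  exact Subtype.ext h ▸ hg'
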